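/- arXiv:1804.10691 — 3 statements merged into one kernel-verified Lean document; each statement's English description precedes it below -/
import Mathlib

section
/- If α and β are any points of the open unit disc D(0;1) in ℂ and r, s are positive real numbers such that the closed disc D̄(α;r) is contained in D(0;1) and the closed disc D̄(β;s) is contained in D(0;1), then there exist t ∈ (0,1) and a homeomorphism h : D̄(0;1) → D̄(0;1) such that D̄(α;r) ⊆ D(0;t), D̄(β;s) ⊆ D(0;t), h[D̄(α;r)] = D̄(β;s), and h(z) = z for every z ∈ D̄(0;1) \ D(0;t). -/
/-- Clamping to `[a, b]`, seen as a function of the norm, does not increase distances. -/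
theorem lipschitzWith_clamp_norm {E : Type*} [SeminormedAddCommGroup E] (a b : ℝ) :
    LipschitzWith 1 fun x : E => max a (min ‖x‖ b) :=
  (lipschitzWith_one_norm.min_const b).const_max a

/-- A homeomorphism that translates `closedBall 0 r` by `a` and is the identity outside
`ball 0 t`. -/
theorem exists_homeomorph_translate_closedBall {E : Type*} [NormedAddCommGroup E]
    [NormedSpace ℝ E] [CompleteSpace E] {a : E} {r t : ℝ} (h : ‖a‖ + r < t) :
    ∃ f : E ≃ₜ E, f '' Metric.closedBall 0 r = Metric.closedBall a r ∧
      ∀ x, t ≤ ‖x‖ → f x = x := by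
  have hrt : 0 < t - r := by linarith [norm_nonneg a]
  have hrt' : r ≤ t := by linarith
  let c : E → ℝ := fun x => (t - max r (min ‖x‖ t)) / (t - r)
  let K : NNReal := ⟨‖a‖ / (t - r), by positivity⟩
  have hK : K < 1 := by
    rw [← NNReal.coe_lt_coe]
    change ‖a‖ / (t - r) < 1
    rw [div_lt_one hrt]
    linarith
  have happrox : ApproximatesLinearOn (fun x => x + c x • a)
      ((ContinuousLinearEquiv.refl ℝ E : E ≃L[ℝ] E) : E →L[ℝ] E) Set.univ K := by
    intro x _ y _
    have hlip := (lipschitzWith_clamp_norm (E := E) r t).dist_le_mul x y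
    rw [NNReal.coe_one, one_mul, Real.dist_eq, dist_eq_norm] at hlip
    have heq : x + c x • a - (y + c y • a)
        - ((ContinuousLinearEquiv.refl ℝ E : E ≃L[ℝ] E) : E →L[ℝ] E) (x - y)
        = (c x - c y) • a := by
      simp only [ContinuousLinearEquiv.coe_coe, ContinuousLinearEquiv.refl_apply, sub_smul]
      abel
    have hc : |c x - c y| = |max r (min ‖x‖ t) - max r (min ‖y‖ t)| / (t - r) := by
      rw [← sub_div, abs_div, abs_of_pos hrt, sub_sub_sub_cancel_left, abs_sub_comm]
    rw [heq, norm_smul, Real.norm_eq_abs, hc]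
    change _ ≤ ‖a‖ / (t - r) * ‖x - y‖
    calc _ = ‖a‖ / (t - r) * |max r (min ‖x‖ t) - max r (min ‖y‖ t)| := by ring
      _ ≤ _ := by gcongr
  have hK' : Subsingleton E ∨
      K < ‖((ContinuousLinearEquiv.refl ℝ E).symm : E →L[ℝ] E)‖₊⁻¹ := by
    rcases subsingleton_or_nontrivial E with hE | hE
    · exact Or.inl hE
    · right
      have : ‖((ContinuousLinearEquiv.refl ℝ E).symm : E →L[ℝ] E)‖₊ = 1 :=
        NNReal.eq ContinuousLinearMap.norm_id
      simpa [this] using hK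
  let f : E ≃ₜ E := happrox.toHomeomorph _ hK'
  have hf (x : E) : f x = x + c x • a := rfl
  refine ⟨f, ?_, fun x hx => ?_⟩
  · have hball : ∀ x ∈ Metric.closedBall (0 : E) r, f x = x + a := by
      intro x hx
      rw [mem_closedBall_zero_iff] at hx
      simp [hf, c, max_eq_left ((min_le_left ‖x‖ t).trans hx), hrt.ne']
    rw [Set.image_congr hball, Set.image_add_right]
    ext x
    simp [← sub_eq_add_neg, dist_eq_norm]
  · simp [hf, c, min_eq_right hx, max_eq_right hrt']

/-- The factor by which a vector of norm `u` is multiplied when the ball of radius `r` is rescaled to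
radius `s` with the outside of the ball of radius `t` held fixed. -/
noncomputable def radialFactor (r s t u : ℝ) : ℝ :=
  ((t - s) + t * (s - r) / max r (min u t)) / (t - r)

theorem radialFactor_of_le {r s t u : ℝ} (hr : 0 < r) (hrt : r < t) (hu : u ≤ r) :
    radialFactor r s t u = s / r := by
  have : t - r ≠ 0 := by linarith
  rw [radialFactor, max_eq_left ((min_le_left _ _).trans hu)]
  field_simp
  ring

theorem radialFactor_of_ge {r s t u : ℝ} (hr : 0 < r) (hrt : r < t) (hu : t ≤ u) :
    radialFactor r s t u = 1 := by
  have : t - r ≠ 0 := by linarith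
  have : t ≠ 0 := by linarith
  rw [radialFactor, min_eq_right hu, max_eq_right hrt.le]
  field_simp
  ring

theorem radialFactor_mul_of_mem {r s t u : ℝ} (hr : 0 < r) (hrt : r < t) (hru : r ≤ u)
    (hut : u ≤ t) : radialFactor r s t u * u = s + (t - s) * (u - r) / (t - r) := by
  have : t - r ≠ 0 := by linarith
  have : u ≠ 0 := by linarith
  rw [radialFactor, min_eq_left hut, max_eq_right hru]
  field_simp
  ring

theorem radialFactor_pos {r s t u : ℝ} (hr : 0 < r) (hs : 0 < s) (hrt : r < t) (hst : s < t) :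
    0 < radialFactor r s t u := by
  rcases le_total u r with hu | hru
  · rw [radialFactor_of_le hr hrt hu]
    positivity
  rcases le_total t u with hu | hut
  · rw [radialFactor_of_ge hr hrt hu]
    exact one_pos
  refine pos_of_mul_pos_left ?_ (hr.le.trans hru)
  rw [radialFactor_mul_of_mem hr hrt hru hut]
  have := div_nonneg (mul_nonneg (sub_nonneg.2 hst.le) (sub_nonneg.2 hru)) (sub_nonneg.2 hrt.le)
  linarith

theorem radialFactor_mul_radialFactor {r s t u : ℝ} (hr : 0 < r) (hs : 0 < s) (hrt : r < t)
    (hst : s < t) :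
    radialFactor s r t (radialFactor r s t u * u) * radialFactor r s t u = 1 := by
  have hrt' : 0 < t - r := sub_pos.2 hrt
  have hst' : 0 < t - s := sub_pos.2 hst
  rcases le_total u r with hu | hru
  · rw [radialFactor_of_le hr hrt hu, radialFactor_of_le hs hst]
    · field_simp
    · rw [div_mul_eq_mul_div, div_le_iff₀ hr]
      gcongr
  rcases le_total t u with hu | hut
  · rw [radialFactor_of_ge hr hrt hu, one_mul, radialFactor_of_ge hs hst hu, one_mul]
  have hu : 0 < u := hr.trans_le hru
  refine mul_right_cancel₀ hu.ne' ?_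
  have hv := radialFactor_mul_of_mem (s := s) hr hrt hru hut
  have hsv : s ≤ radialFactor r s t u * u := by
    rw [hv]
    have := div_nonneg (mul_nonneg hst'.le (sub_nonneg.2 hru)) hrt'.le
    linarith
  have hvt : radialFactor r s t u * u ≤ t := by
    rw [hv]
    have : (t - s) * (u - r) / (t - r) ≤ t - s := by
      rw [div_le_iff₀ hrt']
      gcongr
    linarith
  rw [mul_assoc, radialFactor_mul_of_mem hs hst hsv hvt, hv]
  field_simp
  ring

theorem continuous_radialFactor {r : ℝ} (s t : ℝ) (hr : 0 < r) :
    Continuous (radialFactor r s t) := by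
  unfold radialFactor
  have (u : ℝ) : max r (min u t) ≠ 0 := (hr.trans_le (le_max_left _ _)).ne'
  fun_prop (disch := assumption)

/-- A homeomorphism that rescales `closedBall 0 r` to `closedBall 0 s` and is the identity outside
`ball 0 t`. -/
theorem exists_homeomorph_rescale_closedBall (E : Type*) [NormedAddCommGroup E]
    [NormedSpace ℝ E] {r s t : ℝ} (hr : 0 < r) (hs : 0 < s) (hrt : r < t) (hst : s < t) :
    ∃ f : E ≃ₜ E, f '' Metric.closedBall 0 r = Metric.closedBall 0 s ∧
      ∀ x, t ≤ ‖x‖ → f x = x := by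
  have hinv {r s : ℝ} (hr : 0 < r) (hs : 0 < s) (hrt : r < t) (hst : s < t) :
      Function.LeftInverse (fun x : E => radialFactor s r t ‖x‖ • x)
        fun x => radialFactor r s t ‖x‖ • x := by
    intro x
    simp only [norm_smul, Real.norm_eq_abs, abs_of_pos (radialFactor_pos hr hs hrt hst), smul_smul,
      radialFactor_mul_radialFactor hr hs hrt hst, one_smul]
  let f : E ≃ₜ E :=
    { toFun := fun x => radialFactor r s t ‖x‖ • x
      invFun := fun x => radialFactor s r t ‖x‖ • x
      left_inv := hinv hr hs hrt hst
      right_inv := hinv hs hr hst hrt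
      continuous_toFun := ((continuous_radialFactor s t hr).comp continuous_norm).smul continuous_id
      continuous_invFun :=
        ((continuous_radialFactor r t hs).comp continuous_norm).smul continuous_id }
  have hf (x : E) : f x = radialFactor r s t ‖x‖ • x := rfl
  refine ⟨f, ?_, fun x hx => by rw [hf, radialFactor_of_ge hr hrt hx, one_smul]⟩
  have hball : ∀ x ∈ Metric.closedBall (0 : E) r, f x = (s / r) • x := fun x hx => by
    rw [hf, radialFactor_of_le hr hrt (mem_closedBall_zero_iff.1 hx)]
  rw [Set.image_congr hball, Set.image_smul, smul_closedBall _ _ hr.le, smul_zero,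
    Real.norm_of_nonneg (by positivity), div_mul_cancel₀ _ hr.ne']

/-- A homeomorphism that carries `closedBall a r` to `closedBall b s` and is the identity outside
`ball 0 t`. -/
theorem exists_homeomorph_image_closedBall {E : Type*} [NormedAddCommGroup E]
    [NormedSpace ℝ E] [CompleteSpace E] {a b : E} {r s t : ℝ} (hr : 0 < r) (hs : 0 < s)
    (ha : ‖a‖ + r < t) (hb : ‖b‖ + s < t) :
    ∃ f : E ≃ₜ E, f '' Metric.closedBall a r = Metric.closedBall b s ∧
      ∀ x, t ≤ ‖x‖ → f x = x := by
  obtain ⟨f, hf, hf'⟩ := exists_homeomorph_translate_closedBall ha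
  obtain ⟨g, hg, hg'⟩ := exists_homeomorph_translate_closedBall hb
  obtain ⟨k, hk, hk'⟩ := exists_homeomorph_rescale_closedBall E hr hs
    (by linarith [norm_nonneg a]) (by linarith [norm_nonneg b] : s < t)
  refine ⟨(f.symm.trans k).trans g, ?_, fun x hx => ?_⟩
  · change (g ∘ k ∘ f.symm) '' _ = _
    rw [Set.image_comp, Set.image_comp, ← hf, ← Set.image_comp f.symm f, f.symm_comp_self, Set.image_id, hk, hg]
  · have : f.symm x = x := by rw [f.symm_apply_eq, hf' x hx]
    simp [this, hk' x hx, hg' x hx]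

theorem norm_add_lt_of_closedBall_subset_ball {E : Type*} [NormedAddCommGroup E]
    [NormedSpace ℝ E] [Nontrivial E] {a : E} {r R : ℝ} (hr : 0 ≤ r)
    (h : Metric.closedBall a r ⊆ Metric.ball 0 R) : ‖a‖ + r < R := by
  obtain ⟨e, he, hae⟩ : ∃ e : E, ‖e‖ = 1 ∧ a = ‖a‖ • e := by
    rcases eq_or_ne a 0 with rfl | ha
    · obtain ⟨e, he⟩ := exists_norm_eq E zero_le_one
      exact ⟨e, he, by simp⟩
    · have := norm_ne_zero_iff.2 ha
      exact ⟨‖a‖⁻¹ • a, by simp [norm_smul, this], by simp [smul_smul, this]⟩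
  have hmem : a + r • e ∈ Metric.ball (0 : E) R :=
    h (by simp [norm_smul, he, abs_of_nonneg hr])
  have hnorm : ‖a + r • e‖ = ‖a‖ + r := by
    nth_rw 1 [hae]
    rw [← add_smul, norm_smul, he, mul_one, Real.norm_of_nonneg (by positivity)]
  rwa [mem_ball_zero_iff, hnorm] at hmem

/-- An injection that is the identity outside `ball 0 t` preserves every `closedBall 0 R` with
`t ≤ R`. -/
theorem mem_closedBall_iff_of_eq_outside {E : Type*} [SeminormedAddCommGroup E] {f : E → E}
    (hf : Function.Injective f) {t R : ℝ} (htR : t ≤ R) (h : ∀ x, t ≤ ‖x‖ → f x = x) (x : E) :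
    x ∈ Metric.closedBall (0 : E) R ↔ f x ∈ Metric.closedBall (0 : E) R := by
  rcases le_or_gt t ‖x‖ with hx | hx
  · rw [h x hx]
  · have hfx : ‖f x‖ < t := by
      by_contra! hfx
      rw [hf (h _ hfx)] at hfx
      exact hfx.not_gt hx
    simp [(hx.trans_le htR).le, (hfx.trans_le htR).le]

/-- If α, β ∈ D(0;1) and r, s > 0 with D̄(α;r) ⊆ D(0;1) and D̄(β;s) ⊆ D(0;1),
then there exist t ∈ (0,1) and a homeomorphism h of D̄(0;1) with D̄(α;r) ⊆ D(0;t),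
D̄(β;s) ⊆ D(0;t), h[D̄(α;r)] = D̄(β;s) and h = id on D̄(0;1) \ D(0;t). -/
theorem stmt_0 (α β : ℂ) (r s : ℝ)
    (hα : α ∈ Metric.ball (0 : ℂ) 1) (hβ : β ∈ Metric.ball (0 : ℂ) 1)
    (hr : 0 < r) (hs : 0 < s)
    (hDr : Metric.closedBall α r ⊆ Metric.ball (0 : ℂ) 1)
    (hDs : Metric.closedBall β s ⊆ Metric.ball (0 : ℂ) 1) :
    ∃ t ∈ Set.Ioo (0 : ℝ) 1,
      ∃ h : Metric.closedBall (0 : ℂ) 1 ≃ₜ Metric.closedBall (0 : ℂ) 1,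
        Metric.closedBall α r ⊆ Metric.ball (0 : ℂ) t ∧
        Metric.closedBall β s ⊆ Metric.ball (0 : ℂ) t ∧
        Subtype.val '' (⇑h '' {z : Metric.closedBall (0 : ℂ) 1 | (z : ℂ) ∈ Metric.closedBall α r})
          = Metric.closedBall β s ∧
        ∀ z : Metric.closedBall (0 : ℂ) 1, (z : ℂ) ∉ Metric.ball (0 : ℂ) t → (h z : ℂ) = z := by
  have ha := norm_add_lt_of_closedBall_subset_ball hr.le hDr
  have hb := norm_add_lt_of_closedBall_subset_ball hs.le hDs
  obtain ⟨t, ht, ht1⟩ := exists_between (max_lt ha hb)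
  obtain ⟨hat, hbt⟩ := max_lt_iff.1 ht
  obtain ⟨f, hf, hf'⟩ := exists_homeomorph_image_closedBall hr hs hat hbt
  have hsub {c : ℂ} {ρ : ℝ} (hc : ‖c‖ + ρ < t) : Metric.closedBall c ρ ⊆ Metric.ball 0 t :=
    Metric.closedBall_subset_ball' (by rw [dist_zero_right]; linarith)
  refine ⟨t, ⟨by linarith [norm_nonneg α], ht1⟩,
    f.subtype (mem_closedBall_iff_of_eq_outside f.injective ht1.le hf'), hsub hat, hsub hbt, ?_,
    fun z hz => hf' z (by simpa using hz)⟩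
  rw [← hf]
  ext w
  constructor
  · rintro ⟨_, ⟨z, hz, rfl⟩, rfl⟩
    exact ⟨z, hz, rfl⟩
  · rintro ⟨z, hz, rfl⟩
    exact ⟨_, ⟨⟨z, Metric.ball_subset_closedBall (hDr hz)⟩, hz, rfl⟩, rfl⟩
end

section
/- For every t > 0, the map f^{(t)} is continuously differentiable on the closed unit ball of ℝ^q (the origin being a removable singularity of the partial-derivative formulas), and its derivative at the origin is t times the identity; that is, ∂f_i^{(t)}/∂x_j (0) = 0 for all distinct indices i ≠ j and ∂f_i^{(t)}/∂x_i (0) = t for every index i. -/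
/-- The map f^{(t)}(x) = t·x / (1 + (t−1)‖x‖) on ℝ^q. -/
noncomputable def fMap (q : ℕ) (t : ℝ) (x : EuclideanSpace ℝ (Fin q)) :
    EuclideanSpace ℝ (Fin q) :=
  (t / (1 + (t - 1) * ‖x‖)) • x

/-- If `φ` is continuous at the origin, then `x ↦ φ x • x` is differentiable there. -/
theorem hasFDerivAt_zero_smul_self {E : Type*} [NormedAddCommGroup E] [NormedSpace ℝ E]
    {φ : E → ℝ} (hφ : ContinuousAt φ 0) :
    HasFDerivAt (fun x => φ x • x) (φ 0 • ContinuousLinearMap.id ℝ E) 0 := by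
  rw [hasFDerivAt_iff_isLittleO_nhds_zero]
  have h : (fun x => φ x - φ 0) =o[nhds 0] (fun _ => (1 : ℝ)) := by
    rw [Asymptotics.isLittleO_one_iff]
    simpa using hφ.tendsto.sub_const (φ 0)
  have h' := h.smul_isBigO (Asymptotics.isBigO_refl (fun x : E => x) (nhds 0))
  simpa [sub_smul] using h'

theorem continuousAt_norm_rescaling_factor {E : Type*} [NormedAddCommGroup E] {t : ℝ} {x : E}
    (hx : 1 + (t - 1) * ‖x‖ ≠ 0) :
    ContinuousAt (fun y : E => t / (1 + (t - 1) * ‖y‖)) x :=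
  ContinuousAt.div (by fun_prop) (by fun_prop) hx

section NormRescaling

variable {E : Type*} [NormedAddCommGroup E] [InnerProductSpace ℝ E] {t : ℝ}

theorem contDiffAt_norm_rescaling {x : E} (hx0 : x ≠ 0) (hx : 1 + (t - 1) * ‖x‖ ≠ 0) :
    ContDiffAt ℝ 1 (fun y : E => (t / (1 + (t - 1) * ‖y‖)) • y) x := by
  have hn : ContDiffAt ℝ 1 (fun y : E => ‖y‖) x := contDiffAt_norm ℝ hx0
  exact (contDiffAt_const.div (contDiffAt_const.add (contDiffAt_const.mul hn)) hx).smul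
    contDiffAt_id

theorem hasFDerivAt_norm_rescaling_zero :
    HasFDerivAt (fun y : E => (t / (1 + (t - 1) * ‖y‖)) • y)
      (t • ContinuousLinearMap.id ℝ E) 0 := by
  simpa using hasFDerivAt_zero_smul_self
    (continuousAt_norm_rescaling_factor (E := E) (t := t) (x := 0) (by simp))

/-- The formula also holds at the origin, whatever the value of `fderiv ℝ norm 0`. -/
theorem fderiv_norm_rescaling {x : E} (hx : 1 + (t - 1) * ‖x‖ ≠ 0) :
    fderiv ℝ (fun y : E => (t / (1 + (t - 1) * ‖y‖)) • y) x =
      (t / (1 + (t - 1) * ‖x‖)) • ContinuousLinearMap.id ℝ E +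
      (-(t * (t - 1)) / (1 + (t - 1) * ‖x‖) ^ 2) •
        (fderiv ℝ (fun y : E => ‖y‖) x).smulRight x := by
  rcases eq_or_ne x 0 with rfl | hx0
  · rw [hasFDerivAt_norm_rescaling_zero.fderiv]
    ext v
    simp
  · have hn : HasFDerivAt (fun y : E => ‖y‖) (fderiv ℝ (fun y : E => ‖y‖) x) x :=
      ((contDiffAt_norm ℝ hx0 (n := 1)).differentiableAt one_ne_zero).hasFDerivAt
    have hd := ((hasDerivAt_inv hx).comp_hasFDerivAt x
      ((hn.const_mul (t - 1)).const_add 1)).const_mul t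
    have h := (hd.smul (hasFDerivAt_id x)).fderiv
    simp only [Function.comp_def, id_eq, ← div_eq_mul_inv] at h
    refine h.trans ?_
    ext v
    simp only [add_apply, smul_apply,
      ContinuousLinearMap.smulRight_apply, smul_eq_mul, smul_smul]
    congr 2
    ring

theorem continuousAt_fderiv_norm_rescaling_zero :
    ContinuousAt (fderiv ℝ (fun y : E => (t / (1 + (t - 1) * ‖y‖)) • y)) 0 := by
  have hne : ∀ᶠ x : E in nhds 0, 1 + (t - 1) * ‖x‖ ≠ 0 :=
    ContinuousAt.eventually_ne (by fun_prop) (by simp)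
  refine ContinuousAt.congr ?_ (hne.mono fun x hx => (fderiv_norm_rescaling hx).symm)
  refine ((continuousAt_norm_rescaling_factor (by simp)).smul continuousAt_const).add ?_
  have hc : ContinuousAt (fun x : E => -(t * (t - 1)) / (1 + (t - 1) * ‖x‖) ^ 2) 0 :=
    ContinuousAt.div (by fun_prop) (by fun_prop) (by simp)
  refine hc.smul ?_
  have hv : (fderiv ℝ (fun y : E => ‖y‖) 0).smulRight (0 : E) = 0 := by ext; simp
  refine (squeeze_zero_norm (fun x => ?_) tendsto_norm_zero).trans_eq (congrArg nhds hv.symm)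
  rw [ContinuousLinearMap.norm_smulRight_apply]
  have h1 : ‖fderiv ℝ (fun y : E => ‖y‖) x‖ ≤ 1 := by
    simpa using norm_fderiv_le_of_lipschitz ℝ (x₀ := x) (lipschitzWith_one_norm (E := E))
  exact mul_le_of_le_one_left (norm_nonneg x) h1

theorem contDiffOn_norm_rescaling :
    ContDiffOn ℝ 1 (fun y : E => (t / (1 + (t - 1) * ‖y‖)) • y)
      {x | 1 + (t - 1) * ‖x‖ ≠ 0} := by
  have ho : IsOpen {x : E | 1 + (t - 1) * ‖x‖ ≠ 0} :=
    isOpen_ne_fun (by fun_prop) continuous_const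
  rw [← zero_add (1 : WithTop ℕ∞), contDiffOn_succ_iff_fderiv_of_isOpen ho, contDiffOn_zero]
  refine ⟨fun x hx => ?_, by simp, fun x hx => ?_⟩
  · rcases eq_or_ne x 0 with rfl | hx0
    · exact hasFDerivAt_norm_rescaling_zero.differentiableAt.differentiableWithinAt
    · exact ((contDiffAt_norm_rescaling hx0 hx).differentiableAt
        one_ne_zero).differentiableWithinAt
  · rcases eq_or_ne x 0 with rfl | hx0
    · exact continuousAt_fderiv_norm_rescaling_zero.continuousWithinAt
    · exact ((contDiffAt_norm_rescaling hx0 hx).continuousAt_fderiv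
        one_ne_zero).continuousWithinAt

end NormRescaling

/-- for every t > 0, f^{(t)} is continuously differentiable on the closed unit
ball, its derivative at the origin is t times the identity, and the partial derivatives at the
origin satisfy ∂f_i^{(t)}/∂x_j(0) = 0 for i ≠ j and ∂f_i^{(t)}/∂x_i(0) = t. -/
theorem stmt_9 (q : ℕ) (hq : 2 ≤ q) (t : ℝ) (ht : 0 < t) :
    ContDiffOn ℝ 1 (fMap q t) (Metric.closedBall 0 1) ∧
    HasFDerivAt (fMap q t) (t • ContinuousLinearMap.id ℝ (EuclideanSpace ℝ (Fin q))) 0 ∧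
    (∀ i j : Fin q, i ≠ j →
      fderiv ℝ (fun y : EuclideanSpace ℝ (Fin q) => t * y i / (1 + (t - 1) * ‖y‖)) 0
        (EuclideanSpace.single j 1) = 0) ∧
    (∀ i : Fin q,
      fderiv ℝ (fun y : EuclideanSpace ℝ (Fin q) => t * y i / (1 + (t - 1) * ‖y‖)) 0
        (EuclideanSpace.single i 1) = t) := by
  have hpart : ∀ i : Fin q,
      fderiv ℝ (fun y : EuclideanSpace ℝ (Fin q) => t * y i / (1 + (t - 1) * ‖y‖)) 0 =
        t • EuclideanSpace.proj i := by
    intro i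
    have h := ((EuclideanSpace.proj i : EuclideanSpace ℝ (Fin q) →L[ℝ] ℝ).hasFDerivAt.comp 0
      (hasFDerivAt_norm_rescaling_zero (t := t))).fderiv
    have hf : (fun y : EuclideanSpace ℝ (Fin q) => t * y i / (1 + (t - 1) * ‖y‖)) =
        (EuclideanSpace.proj i : EuclideanSpace ℝ (Fin q) →L[ℝ] ℝ) ∘
          fun y => (t / (1 + (t - 1) * ‖y‖)) • y := by
      ext y
      simp [div_mul_eq_mul_div]
    rw [hf]
    refine h.trans ?_
    ext v
    simp
  refine ⟨contDiffOn_norm_rescaling.mono fun x hx => ?_, hasFDerivAt_norm_rescaling_zero,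
    fun i j hij => ?_, fun i => ?_⟩
  · have hx1 : ‖x‖ ≤ 1 := by simpa using hx
    have hpos : 0 < 1 + (t - 1) * ‖x‖ := by
      rcases hx1.eq_or_lt with h | h
      · simpa [h] using ht
      · nlinarith [mul_nonneg ht.le (norm_nonneg x)]
    exact hpos.ne'
  · simp [hpart, hij]
  · simp [hpart]
end

section
/- For every t with 0 < t < 1, the maximum over x in the closed unit ball of ℝ^q of ‖f^{(t)}(x) − x‖ equals (1 − 2√t + t)/(1 − t). -/
theorem norm_fMap_sub_self {q : ℕ} {t : ℝ} (ht0 : 0 < t) (ht1 : t < 1)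
    {x : EuclideanSpace ℝ (Fin q)} (hx : ‖x‖ ≤ 1) :
    ‖fMap q t x - x‖ = (1 - t) * (1 - ‖x‖) * ‖x‖ / (1 + (t - 1) * ‖x‖) := by
  have hD : 0 < 1 + (t - 1) * ‖x‖ := by nlinarith
  have hcoef : t / (1 + (t - 1) * ‖x‖) - 1 =
      -((1 - t) * (1 - ‖x‖) / (1 + (t - 1) * ‖x‖)) := by
    field_simp
    ring
  have hnonneg : 0 ≤ (1 - t) * (1 - ‖x‖) / (1 + (t - 1) * ‖x‖) :=
    div_nonneg (mul_nonneg (by linarith) (by linarith)) hD.le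
  have hsmul : fMap q t x - x = (t / (1 + (t - 1) * ‖x‖) - 1) • x := by
    rw [fMap, sub_smul, one_smul]
  rw [hsmul, norm_smul, hcoef, norm_neg, Real.norm_of_nonneg hnonneg]
  ring

/-- for every 0 < t < 1, the maximum over the closed unit ball of
‖f^{(t)}(x) − x‖ equals (1 − 2√t + t)/(1 − t). -/
theorem stmt_13 (q : ℕ) (hq : 2 ≤ q) (t : ℝ) (ht0 : 0 < t) (ht1 : t < 1) :
    IsGreatest {y : ℝ | ∃ x : EuclideanSpace ℝ (Fin q), ‖x‖ ≤ 1 ∧ y = ‖fMap q t x - x‖}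
      ((1 - 2 * Real.sqrt t + t) / (1 - t)) := by
  obtain ⟨s, hs0, hs1, rfl⟩ : ∃ s : ℝ, 0 < s ∧ s < 1 ∧ t = s ^ 2 :=
    ⟨√t, Real.sqrt_pos.2 ht0, (Real.sqrt_lt' one_pos).2 (by simpa using ht1),
      (Real.sq_sqrt ht0.le).symm⟩
  have hval : (1 - 2 * √(s ^ 2) + s ^ 2) / (1 - s ^ 2) = (1 - s) / (1 + s) := by
    have h1 : 1 - s ^ 2 ≠ 0 := by linarith
    rw [Real.sqrt_sq hs0.le, div_eq_div_iff h1 (by positivity)]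
    ring
  rw [hval]
  constructor
  · have : Nonempty (Fin q) := ⟨⟨0, by lia⟩⟩
    obtain ⟨x, hx⟩ := exists_norm_eq (EuclideanSpace ℝ (Fin q))
      (show 0 ≤ 1 / (1 + s) by positivity)
    have hx1 : ‖x‖ ≤ 1 := by
      rw [hx, div_le_one (by positivity)]
      linarith
    refine ⟨x, hx1, ?_⟩
    have hD : 1 + (s ^ 2 - 1) * (1 / (1 + s)) = s := by
      field_simp
      ring
    rw [norm_fMap_sub_self ht0 ht1 hx1, hx, hD]
    field_simp
    ring
  · rintro _ ⟨x, hx, rfl⟩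
    have hD : 0 < 1 + (s ^ 2 - 1) * ‖x‖ := by nlinarith [norm_nonneg x]
    rw [norm_fMap_sub_self ht0 ht1 hx, div_le_div_iff₀ hD (by positivity)]
    nlinarith [mul_nonneg (sub_nonneg.2 hs1.le) (sq_nonneg (1 - (1 + s) * ‖x‖))]
end
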